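/- Let x, y : ℝ → S³ ⊂ ℝ⁴ be C¹ closed curves (periodic with positive periods, with nowhere-vanishing derivatives) whose images are disjoint, and suppose the signed area density vanishes identically: A(s,t) = 0 for all (s,t). Then both components of the link are circles: there exist 2-dimensional affine planes P₁, P₂ ⊆ ℝ⁴ such that the image of x is contained in P₁ ∩ S³ and the image of y is contained in P₂ ∩ S³. -/

import Mathlib

open Matrix

lemma HasDerivAt.dotProduct_const_right {x : ℝ → Fin 4 → ℝ} {x' : Fin 4 → ℝ} {s : ℝ}
    (h : HasDerivAt x x' s) (v : Fin 4 → ℝ) :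
    HasDerivAt (fun s => x s ⬝ᵥ v) (x' ⬝ᵥ v) s :=
  HasDerivAt.fun_sum fun i _ => (hasDerivAt_pi.1 h i).mul_const (v i)

/-- Vanishing of the signed area density makes `x s ⬝ᵥ y t - 1` a product of a function of `s`
and a function of `t`. -/
lemma dotProduct_sub_one_mul_eq_of_density_eq_zero {x y : ℝ → Fin 4 → ℝ}
    (hx : Differentiable ℝ x) (hy : Differentiable ℝ y)
    (hne : ∀ s t, x s ⬝ᵥ y t - 1 ≠ 0)
    (hA : ∀ s t : ℝ,
      ((deriv x s ⬝ᵥ deriv y t) * (x s ⬝ᵥ y t - 1)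
        - (deriv x s ⬝ᵥ y t) * (x s ⬝ᵥ deriv y t)) / (x s ⬝ᵥ y t - 1) ^ 2 = 0)
    (s s₀ t t₀ : ℝ) :
    (x s ⬝ᵥ y t - 1) * (x s₀ ⬝ᵥ y t₀ - 1) = (x s ⬝ᵥ y t₀ - 1) * (x s₀ ⬝ᵥ y t - 1) := by
  have hdy : ∀ v t, HasDerivAt (fun t => v ⬝ᵥ y t) (v ⬝ᵥ deriv y t) t := fun v t => by
    simpa only [dotProduct_comm v] using (hy t).hasDerivAt.dotProduct_const_right v
  have hlog : ∀ s t, deriv x s ⬝ᵥ y t / (x s ⬝ᵥ y t - 1)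
      = deriv x s ⬝ᵥ y t₀ / (x s ⬝ᵥ y t₀ - 1) := fun s t => by
    have hd : ∀ t, HasDerivAt (fun t => deriv x s ⬝ᵥ y t / (x s ⬝ᵥ y t - 1)) 0 t := fun t => by
      simpa only [hA] using (hdy (deriv x s) t).fun_div ((hdy (x s) t).sub_const 1) (hne s t)
    exact is_const_of_deriv_eq_zero (fun t => (hd t).differentiableAt) (fun t => (hd t).deriv) t t₀
  have hd : ∀ s, HasDerivAt (fun s => (x s ⬝ᵥ y t - 1) / (x s ⬝ᵥ y t₀ - 1)) 0 s := fun s => by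
    have hdx := fun v => ((hx s).hasDerivAt.dotProduct_const_right v).sub_const 1
    have h := hlog s t
    rw [div_eq_div_iff (hne s t) (hne s t₀)] at h
    refine ((hdx (y t)).fun_div (hdx (y t₀)) (hne s t₀)).congr_deriv ?_
    rw [div_eq_zero_iff]
    left
    linear_combination h
  have h := is_const_of_deriv_eq_zero (fun s => (hd s).differentiableAt)
    (fun s => (hd s).deriv) s s₀
  rw [div_eq_div_iff (hne s t₀) (hne s₀ t₀)] at h
  linear_combination h

lemma dotProduct_ne_one_of_ne {u v : Fin 4 → ℝ} (hu : u ⬝ᵥ u = 1) (hv : v ⬝ᵥ v = 1)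
    (huv : u ≠ v) : u ⬝ᵥ v ≠ 1 := by
  intro h
  refine huv (sub_eq_zero.1 (dotProduct_self_eq_zero.1 ?_))
  rw [sub_dotProduct, dotProduct_sub, dotProduct_sub, dotProduct_comm v u]
  linarith

/-- Three distinct points of the unit sphere are affinely independent. -/
lemma eq_zero_of_affine_relation_on_sphere {u v w : Fin 4 → ℝ} (hu : u ⬝ᵥ u = 1)
    (hv : v ⬝ᵥ v = 1) (hw : w ⬝ᵥ w = 1) (huv : u ≠ v) (huw : u ≠ w) (hvw : v ≠ w) {c d : ℝ}
    (h : c • v + d • w = (c + d) • u) : c = 0 ∧ d = 0 := by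
  have h₁ := congrArg (· ⬝ᵥ u) h
  have h₂ := congrArg (· ⬝ᵥ v) h
  have h₃ := congrArg (· ⬝ᵥ w) h
  simp only [add_dotProduct, smul_dotProduct, smul_eq_mul, hu, hv, hw, dotProduct_comm v u,
    dotProduct_comm w u, dotProduct_comm w v] at h₁ h₂ h₃
  have huv := dotProduct_ne_one_of_ne hu hv huv
  have huw := dotProduct_ne_one_of_ne hu hw huw
  have hvw := dotProduct_ne_one_of_ne hv hw hvw
  grind

lemma exists_plane_of_dotProduct_eq {m n : Fin 4 → ℝ} (h : LinearIndependent ℝ ![m, n])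
    (p : Fin 4 → ℝ) :
    ∃ v w : Fin 4 → ℝ, LinearIndependent ℝ ![v, w] ∧
      ∀ z, m ⬝ᵥ z = m ⬝ᵥ p → n ⬝ᵥ z = n ⬝ᵥ p → ∃ a b : ℝ, z = p + a • v + b • w := by
  let M : Matrix (Fin 2) (Fin 4) ℝ := ![m, n]
  have hrank : M.rank = 2 := by simpa using LinearIndependent.rank_matrix (M := M) h
  have hker : Module.finrank ℝ M.mulVecLin.ker = 2 := by
    have := M.mulVecLin.finrank_range_add_finrank_ker
    rw [Matrix.rank] at hrank
    simp only [Module.finrank_fin_fun] at this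
    omega
  let b := Module.finBasisOfFinrankEq ℝ M.mulVecLin.ker hker
  refine ⟨b 0, b 1, ?_, fun z hm hn => ?_⟩
  · have hb := b.linearIndependent.map' M.mulVecLin.ker.subtype (Submodule.ker_subtype _)
    have heq : M.mulVecLin.ker.subtype ∘ b = ![(b 0 : Fin 4 → ℝ), (b 1 : Fin 4 → ℝ)] := by
      ext i j
      fin_cases i <;> rfl
    rwa [heq] at hb
  · have hz : z - p ∈ M.mulVecLin.ker := by
      rw [LinearMap.mem_ker, Matrix.mulVecLin_apply]
      ext i
      fin_cases i
      · exact (dotProduct_sub m z p).trans (sub_eq_zero.2 hm)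
      · exact (dotProduct_sub n z p).trans (sub_eq_zero.2 hn)
    have hsum := congrArg Subtype.val (b.sum_repr ⟨z - p, hz⟩)
    simp only [Fin.sum_univ_two, Submodule.coe_add, Submodule.coe_smul] at hsum
    exact ⟨_, _, by rw [add_assoc, hsum, add_sub_cancel]⟩

lemma exists_three_distinct_values {y : ℝ → Fin 4 → ℝ} (hy : Continuous y)
    (hy' : ∀ t, deriv y t ≠ 0) : ∃ r t u, y r ≠ y t ∧ y r ≠ y u ∧ y t ≠ y u := by
  have hnt : (Set.range y).Nontrivial := by
    by_contra hsub
    rw [Set.not_nontrivial_iff] at hsub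
    have hconst : y = fun _ => y 0 := funext fun t => hsub ⟨t, rfl⟩ ⟨0, rfl⟩
    exact hy' 0 (by rw [hconst, deriv_const])
  obtain ⟨F, hF, hcard⟩ := ((isPreconnected_range hy).infinite_of_nontrivial
    hnt).exists_subset_card_eq 3
  obtain ⟨a, b, c, hab, hac, hbc, rfl⟩ := Finset.card_eq_three.1 hcard
  obtain ⟨r, rfl⟩ := hF (by simp : a ∈ _)
  obtain ⟨t, rfl⟩ := hF (by simp : b ∈ _)
  obtain ⟨u, rfl⟩ := hF (by simp : c ∈ _)
  exact ⟨r, t, u, hab, hac, hbc⟩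

lemma exists_plane_of_density_eq_zero {x y : ℝ → Fin 4 → ℝ}
    (hx : Differentiable ℝ x) (hy : Differentiable ℝ y)
    (hxS : ∀ s, x s ⬝ᵥ x s = 1) (hyS : ∀ t, y t ⬝ᵥ y t = 1)
    (hy' : ∀ t, deriv y t ≠ 0) (hdisj : ∀ s t, x s ≠ y t)
    (hA : ∀ s t : ℝ,
      ((deriv x s ⬝ᵥ deriv y t) * (x s ⬝ᵥ y t - 1)
        - (deriv x s ⬝ᵥ y t) * (x s ⬝ᵥ deriv y t)) / (x s ⬝ᵥ y t - 1) ^ 2 = 0) :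
    ∃ (p v w : Fin 4 → ℝ), LinearIndependent ℝ ![v, w] ∧
      ∀ s : ℝ, ∃ a b : ℝ, x s = p + a • v + b • w := by
  have hne : ∀ s t, x s ⬝ᵥ y t - 1 ≠ 0 := fun s t =>
    sub_ne_zero.2 (dotProduct_ne_one_of_ne (hxS s) (hyS t) (hdisj s t))
  have hprod := dotProduct_sub_one_mul_eq_of_density_eq_zero hx hy hne hA
  obtain ⟨r, t, u, hrt, hru, htu⟩ := exists_three_distinct_values hy.continuous hy'
  let k : ℝ → ℝ := fun t => (x 0 ⬝ᵥ y t - 1) / (x 0 ⬝ᵥ y r - 1)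
  have hk : ∀ t s, (y t - k t • y r) ⬝ᵥ x s = 1 - k t := fun t s => by
    have hkt : k t * (x 0 ⬝ᵥ y r - 1) = x 0 ⬝ᵥ y t - 1 := div_mul_cancel₀ _ (hne 0 r)
    rw [sub_dotProduct, smul_dotProduct, smul_eq_mul, dotProduct_comm _ (x s),
      dotProduct_comm _ (x s)]
    apply mul_right_cancel₀ (hne 0 r)
    linear_combination hprod s 0 t r - (x s ⬝ᵥ y r - 1) * hkt
  have hind : LinearIndependent ℝ ![y t - k t • y r, y u - k u • y r] := by
    refine LinearIndependent.pair_iff.2 fun c d h => ?_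
    have hcoef : c + d = c * k t + d * k u := by
      have h₀ := congrArg (· ⬝ᵥ x 0) h
      simp only [add_dotProduct, smul_dotProduct, smul_eq_mul, hk, zero_dotProduct] at h₀
      linear_combination h₀
    refine eq_zero_of_affine_relation_on_sphere (hyS r) (hyS t) (hyS u) hrt hru htu ?_
    rw [hcoef]
    rw [← sub_eq_zero, ← h]
    module
  obtain ⟨v, w, hvw, hplane⟩ := exists_plane_of_dotProduct_eq hind (x 0)
  exact ⟨x 0, v, w, hvw, fun s => hplane (x s) (by rw [hk, hk]) (by rw [hk, hk])⟩

/-- if the signed area density of a link vanishes identically, then both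
components are circles, i.e. each is contained in the intersection of `S³` with a
2-dimensional affine plane of ℝ⁴. -/
theorem vanishing_density_components_are_circles
    (x y : ℝ → (Fin 4 → ℝ)) (L₁ L₂ : ℝ)
    (hx : ContDiff ℝ 1 x) (hy : ContDiff ℝ 1 y)
    (hxS : ∀ s, x s ⬝ᵥ x s = 1) (hyS : ∀ t, y t ⬝ᵥ y t = 1)
    (hL₁ : 0 < L₁) (hL₂ : 0 < L₂)
    (hperx : ∀ s, x (s + L₁) = x s) (hpery : ∀ t, y (t + L₂) = y t)
    (hx' : ∀ s, deriv x s ≠ 0) (hy' : ∀ t, deriv y t ≠ 0)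
    (hdisj : ∀ s t, x s ≠ y t)
    (hA : ∀ s t : ℝ,
      ((deriv x s ⬝ᵥ deriv y t) * (x s ⬝ᵥ y t - 1)
        - (deriv x s ⬝ᵥ y t) * (x s ⬝ᵥ deriv y t)) / (x s ⬝ᵥ y t - 1) ^ 2 = 0) :
    (∃ (p v w : Fin 4 → ℝ), LinearIndependent ℝ ![v, w] ∧
      ∀ s : ℝ, ∃ a b : ℝ, x s = p + a • v + b • w) ∧
    (∃ (p v w : Fin 4 → ℝ), LinearIndependent ℝ ![v, w] ∧
      ∀ t : ℝ, ∃ a b : ℝ, y t = p + a • v + b • w) := by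
  have hdx := hx.differentiable one_ne_zero
  have hdy := hy.differentiable one_ne_zero
  refine ⟨exists_plane_of_density_eq_zero hdx hdy hxS hyS hy' hdisj hA,
    exists_plane_of_density_eq_zero hdy hdx hyS hxS hx' (fun t s => (hdisj s t).symm)
      fun t s => ?_⟩
  rw [dotProduct_comm (deriv y t), dotProduct_comm (y t), dotProduct_comm (deriv y t),
    dotProduct_comm (y t), mul_comm (x s ⬝ᵥ deriv y t)]
  exact hA s t
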